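/- Equivalence of SC_TML and the natural deduction system ND_TML: for every finite set Γ of formulas and every nonempty finite list δ₁, …, δₖ of formulas, the sequent Γ ⇒ {δ₁, …, δₖ} is derivable in SC_TML if and only if there is a deduction in ND_TML of the disjunction δ₁ ∨ ⋯ ∨ δₖ from the set of open assumptions Γ. -/

import Mathlib

/-- Formulas built from propositional variables by the connectives `∧`, `∨`, `¬`, `□`
(no `⊥`). -/
inductive Formula : Type where
  | var : ℕ → Formula
  | and : Formula → Formula → Formula
  | or : Formula → Formula → Formula
  | neg : Formula → Formula
  | box : Formula → Formula
deriving DecidableEq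
/-- The two-sided sequent calculus `SC_TML`.  `SCder c Γ Δ` means the sequent `Γ ⇒ Δ`
has a derivation; when `c = false` the cut rule is not allowed (cut-free derivability),
`SCder true` is plain derivability. -/
inductive SCder : Bool → Finset Formula → Finset Formula → Prop where
  | ax (c : Bool) (α : Formula) : SCder c {α} {α}
  | weakL {c Γ Δ} (α : Formula) : SCder c Γ Δ → SCder c (insert α Γ) Δ
  | weakR {c Γ Δ} (α : Formula) : SCder c Γ Δ → SCder c Γ (insert α Δ)
  | cut {Γ Δ : Finset Formula} {α : Formula} :
      SCder true Γ (insert α Δ) → SCder true (insert α Γ) Δ → SCder true Γ Δ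
  | andL {c Γ Δ} (α β : Formula) :
      SCder c (insert α (insert β Γ)) Δ → SCder c (insert (α.and β) Γ) Δ
  | andR {c Γ Δ} (α β : Formula) :
      SCder c Γ (insert α Δ) → SCder c Γ (insert β Δ) → SCder c Γ (insert (α.and β) Δ)
  | nandL {c Γ Δ} (α β : Formula) :
      SCder c (insert α.neg Γ) Δ → SCder c (insert β.neg Γ) Δ →
      SCder c (insert (α.and β).neg Γ) Δ
  | nandR {c Γ Δ} (α β : Formula) :
      SCder c Γ (insert α.neg (insert β.neg Δ)) → SCder c Γ (insert (α.and β).neg Δ)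
  | orL {c Γ Δ} (α β : Formula) :
      SCder c (insert α Γ) Δ → SCder c (insert β Γ) Δ → SCder c (insert (α.or β) Γ) Δ
  | orR {c Γ Δ} (α β : Formula) :
      SCder c Γ (insert α (insert β Δ)) → SCder c Γ (insert (α.or β) Δ)
  | norL {c Γ Δ} (α β : Formula) :
      SCder c (insert α.neg (insert β.neg Γ)) Δ → SCder c (insert (α.or β).neg Γ) Δ
  | norR {c Γ Δ} (α β : Formula) :
      SCder c Γ (insert α.neg Δ) → SCder c Γ (insert β.neg Δ) →
      SCder c Γ (insert (α.or β).neg Δ)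
  | nnL {c Γ Δ} (α : Formula) : SCder c (insert α Γ) Δ → SCder c (insert α.neg.neg Γ) Δ
  | nnR {c Γ Δ} (α : Formula) : SCder c Γ (insert α Δ) → SCder c Γ (insert α.neg.neg Δ)
  | boxL1 {c Γ Δ} (α : Formula) : SCder c (insert α Γ) Δ → SCder c (insert α.box Γ) Δ
  | boxL2 {c Γ Δ} (α : Formula) : SCder c Γ (insert α.neg Δ) → SCder c (insert α.box Γ) Δ
  | boxR {c Γ Δ} (α : Formula) :
      SCder c Γ (insert α Δ) → SCder c (insert α.neg Γ) Δ → SCder c Γ (insert α.box Δ)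
  | nboxL {c Γ Δ} (α : Formula) :
      SCder c Γ (insert α Δ) → SCder c (insert α.neg Γ) Δ → SCder c (insert α.box.neg Γ) Δ
  | nboxR1 {c Γ Δ} (α : Formula) : SCder c (insert α Γ) Δ → SCder c Γ (insert α.box.neg Δ)
  | nboxR2 {c Γ Δ} (α : Formula) : SCder c Γ (insert α.neg Δ) → SCder c Γ (insert α.box.neg Δ)
/-- Formulas built from propositional variables and the constant `⊥`
by the connectives `∧`, `∨`, `¬`, `□`. -/
inductive FormulaB : Type where
  | var : ℕ → FormulaB
  | bot : FormulaB
  | and : FormulaB → FormulaB → FormulaB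
  | or : FormulaB → FormulaB → FormulaB
  | neg : FormulaB → FormulaB
  | box : FormulaB → FormulaB
deriving DecidableEq

/-- The natural deduction system `ND_TML`.  `NDder Γ φ` means there is a deduction of
`φ` whose open assumptions all belong to the set `Γ`. -/
inductive NDder : Set FormulaB → FormulaB → Prop where
  | hyp {Γ} {φ : FormulaB} : φ ∈ Γ → NDder Γ φ
  | ma {Γ} (φ : FormulaB) : NDder Γ (φ.or φ.box.neg)
  | andI {Γ} {φ ψ : FormulaB} : NDder Γ φ → NDder Γ ψ → NDder Γ (φ.and ψ)
  | andE1 {Γ} {φ ψ : FormulaB} : NDder Γ (φ.and ψ) → NDder Γ φ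
  | andE2 {Γ} {φ ψ : FormulaB} : NDder Γ (φ.and ψ) → NDder Γ ψ
  | nandI1 {Γ} {φ : FormulaB} (ψ : FormulaB) : NDder Γ φ.neg → NDder Γ (φ.and ψ).neg
  | nandI2 {Γ} (φ : FormulaB) {ψ : FormulaB} : NDder Γ ψ.neg → NDder Γ (φ.and ψ).neg
  | nandE {Γ} {φ ψ χ : FormulaB} : NDder Γ (φ.and ψ).neg →
      NDder (insert φ.neg Γ) χ → NDder (insert ψ.neg Γ) χ → NDder Γ χ
  | orI1 {Γ} {φ : FormulaB} (ψ : FormulaB) : NDder Γ φ → NDder Γ (φ.or ψ)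
  | orI2 {Γ} (φ : FormulaB) {ψ : FormulaB} : NDder Γ ψ → NDder Γ (φ.or ψ)
  | orE {Γ} {φ ψ χ : FormulaB} : NDder Γ (φ.or ψ) →
      NDder (insert φ Γ) χ → NDder (insert ψ Γ) χ → NDder Γ χ
  | norI {Γ} {φ ψ : FormulaB} : NDder Γ φ.neg → NDder Γ ψ.neg → NDder Γ (φ.or ψ).neg
  | norE1 {Γ} {φ ψ : FormulaB} : NDder Γ (φ.or ψ).neg → NDder Γ φ.neg
  | norE2 {Γ} {φ ψ : FormulaB} : NDder Γ (φ.or ψ).neg → NDder Γ ψ.neg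
  | nnI {Γ} {φ : FormulaB} : NDder Γ φ → NDder Γ φ.neg.neg
  | nnE {Γ} {φ : FormulaB} : NDder Γ φ.neg.neg → NDder Γ φ
  | boxIstar {Γ} {ψ φ : FormulaB} : NDder Γ (ψ.or φ) →
      NDder (insert φ.neg Γ) ψ → NDder Γ (ψ.or φ.box)
  | boxE {Γ} {φ : FormulaB} : NDder Γ φ.box → NDder Γ φ
  | nboxI {Γ} {φ : FormulaB} : NDder Γ φ.neg → NDder Γ φ.box.neg
  | nboxE {Γ} {φ : FormulaB} : NDder Γ φ.box.neg → NDder Γ φ → NDder Γ φ.neg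
  | botI {Γ} {φ : FormulaB} : NDder Γ (φ.neg.and φ.box) → NDder Γ FormulaB.bot
  | botE {Γ} (α : FormulaB) : NDder Γ FormulaB.bot → NDder Γ α

/-- The canonical embedding of ⊥-free formulas into formulas with `⊥`. -/
def Formula.emb : Formula → FormulaB
  | .var n => .var n
  | .and φ ψ => .and φ.emb ψ.emb
  | .or φ ψ => .or φ.emb ψ.emb
  | .neg φ => .neg φ.emb
  | .box φ => .box φ.emb

/-- The disjunction `δ₁ ∨ (δ₂ ∨ (⋯ ∨ δₖ))` of a nonempty list of formulas. -/
def disj : Formula → List Formula → Formula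
  | φ, [] => φ
  | φ, ψ :: l => φ.or (disj ψ l)

theorem NDder.mono {S T : Set FormulaB} {φ : FormulaB} (h : NDder S φ) (hST : S ⊆ T) :
    NDder T φ := by
  induction h generalizing T with
  | hyp h => exact .hyp (hST h)
  | ma φ => exact .ma φ
  | andI _ _ ih₁ ih₂ => exact .andI (ih₁ hST) (ih₂ hST)
  | andE1 _ ih => exact .andE1 (ih hST)
  | andE2 _ ih => exact .andE2 (ih hST)
  | nandI1 ψ _ ih => exact .nandI1 ψ (ih hST)
  | nandI2 φ _ ih => exact .nandI2 φ (ih hST)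
  | nandE _ _ _ ih ih₁ ih₂ =>
    exact .nandE (ih hST) (ih₁ (Set.insert_subset_insert hST)) (ih₂ (Set.insert_subset_insert hST))
  | orI1 ψ _ ih => exact .orI1 ψ (ih hST)
  | orI2 φ _ ih => exact .orI2 φ (ih hST)
  | orE _ _ _ ih ih₁ ih₂ =>
    exact .orE (ih hST) (ih₁ (Set.insert_subset_insert hST)) (ih₂ (Set.insert_subset_insert hST))
  | norI _ _ ih₁ ih₂ => exact .norI (ih₁ hST) (ih₂ hST)
  | norE1 _ ih => exact .norE1 (ih hST)
  | norE2 _ ih => exact .norE2 (ih hST)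
  | nnI _ ih => exact .nnI (ih hST)
  | nnE _ ih => exact .nnE (ih hST)
  | boxIstar _ _ ih₁ ih₂ => exact .boxIstar (ih₁ hST) (ih₂ (Set.insert_subset_insert hST))
  | boxE _ ih => exact .boxE (ih hST)
  | nboxI _ ih => exact .nboxI (ih hST)
  | nboxE _ _ ih₁ ih₂ => exact .nboxE (ih₁ hST) (ih₂ hST)
  | botI _ ih => exact .botI (ih hST)
  | botE α _ ih => exact .botE α (ih hST)

theorem NDder.weak {S : Set FormulaB} {φ : FormulaB} (ψ : FormulaB) (h : NDder S φ) :
    NDder (insert ψ S) φ :=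
  h.mono (Set.subset_insert ψ S)

theorem NDder.head {S : Set FormulaB} {φ : FormulaB} : NDder (insert φ S) φ :=
  .hyp (Set.mem_insert φ S)

theorem NDder.subst {S : Set FormulaB} {φ χ : FormulaB} (h : NDder S φ)
    (hχ : NDder (insert φ S) χ) : NDder S χ :=
  .orE (.orI1 φ h) hχ hχ

/-- Replace the assumption `φ` by an assumption `ψ` from which it follows. -/
theorem NDder.replace {S : Set FormulaB} {φ ψ χ : FormulaB} (hχ : NDder (insert φ S) χ)
    (h : NDder (insert ψ S) φ) : NDder (insert ψ S) χ :=
  h.subst (hχ.mono (Set.insert_subset_insert (Set.subset_insert ψ S)))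

/-- A derivable sequent `Γ ⇒ Δ` yields elimination by cases over `Δ` in any context
from which all formulas of `Γ` are derivable. -/
theorem SCder.nd_cases {c : Bool} {Γ Δ : Finset Formula} (h : SCder c Γ Δ)
    {S : Set FormulaB} {χ : FormulaB} (hΓ : ∀ γ ∈ Γ, NDder S γ.emb)
    (hΔ : ∀ δ ∈ Δ, NDder (insert δ.emb S) χ) : NDder S χ := by
  have ext {Γ : Finset Formula} {S : Set FormulaB} (α : Formula)
      (hΓ : ∀ γ ∈ Γ, NDder S γ.emb) : ∀ γ ∈ insert α Γ, NDder (insert α.emb S) γ.emb :=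
    Finset.forall_mem_insert .. |>.2 ⟨.head, fun γ hγ => (hΓ γ hγ).weak _⟩
  have wk {Δ : Finset Formula} {S : Set FormulaB} {χ : FormulaB} (φ : FormulaB)
      (hΔ : ∀ δ ∈ Δ, NDder (insert δ.emb S) χ) :
      ∀ δ ∈ Δ, NDder (insert δ.emb (insert φ S)) χ := fun δ hδ =>
    (hΔ δ hδ).mono (Set.insert_subset_insert (Set.subset_insert φ S))
  induction h generalizing S χ with
  | ax c α => exact (hΓ α (by simp)).subst (hΔ α (by simp))
  | weakL α _ ih => exact ih (fun γ hγ => hΓ γ (Finset.mem_insert_of_mem hγ)) hΔ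
  | weakR α _ ih => exact ih hΓ (fun δ hδ => hΔ δ (Finset.mem_insert_of_mem hδ))
  | cut _ _ ih₁ ih₂ =>
    exact ih₁ hΓ (Finset.forall_mem_insert .. |>.2 ⟨ih₂ (ext _ hΓ) (wk _ hΔ), hΔ⟩)
  | andL α β _ ih =>
    simp only [Finset.forall_mem_insert] at hΓ ih
    exact ih ⟨hΓ.1.andE1, hΓ.1.andE2, hΓ.2⟩ hΔ
  | andR α β _ _ ih₁ ih₂ =>
    simp only [Finset.forall_mem_insert] at hΔ ih₁ ih₂
    refine ih₁ hΓ ⟨ih₂ (fun γ hγ => (hΓ γ hγ).weak _) ⟨?_, wk _ hΔ.2⟩, hΔ.2⟩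
    exact .subst (.andI (NDder.head.weak _) .head)
      (hΔ.1.mono (Set.insert_subset_insert
        ((Set.subset_insert _ _).trans (Set.subset_insert _ _))))
  | nandL α β _ _ ih₁ ih₂ =>
    have hΓ' := Finset.forall_mem_insert .. |>.1 hΓ
    exact .nandE hΓ'.1 (ih₁ (ext α.neg hΓ'.2) (wk _ hΔ)) (ih₂ (ext β.neg hΓ'.2) (wk _ hΔ))
  | nandR α β _ ih =>
    simp only [Finset.forall_mem_insert] at hΔ ih
    exact ih hΓ ⟨hΔ.1.replace (.nandI1 _ .head), hΔ.1.replace (.nandI2 _ .head), hΔ.2⟩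
  | orL α β _ _ ih₁ ih₂ =>
    have hΓ' := Finset.forall_mem_insert .. |>.1 hΓ
    exact .orE hΓ'.1 (ih₁ (ext α hΓ'.2) (wk _ hΔ)) (ih₂ (ext β hΓ'.2) (wk _ hΔ))
  | orR α β _ ih =>
    simp only [Finset.forall_mem_insert] at hΔ ih
    exact ih hΓ ⟨hΔ.1.replace (.orI1 _ .head), hΔ.1.replace (.orI2 _ .head), hΔ.2⟩
  | norL α β _ ih =>
    simp only [Finset.forall_mem_insert] at hΓ ih
    exact ih ⟨hΓ.1.norE1, hΓ.1.norE2, hΓ.2⟩ hΔ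
  | norR α β _ _ ih₁ ih₂ =>
    simp only [Finset.forall_mem_insert] at hΔ ih₁ ih₂
    refine ih₁ hΓ ⟨ih₂ (fun γ hγ => (hΓ γ hγ).weak _) ⟨?_, wk _ hΔ.2⟩, hΔ.2⟩
    exact .subst (.norI (NDder.head.weak _) .head)
      (hΔ.1.mono (Set.insert_subset_insert
        ((Set.subset_insert _ _).trans (Set.subset_insert _ _))))
  | nnL α _ ih =>
    simp only [Finset.forall_mem_insert] at hΓ ih
    exact ih ⟨hΓ.1.nnE, hΓ.2⟩ hΔ
  | nnR α _ ih =>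
    simp only [Finset.forall_mem_insert] at hΔ ih
    exact ih hΓ ⟨hΔ.1.replace (.nnI .head), hΔ.2⟩
  | boxL1 α _ ih =>
    simp only [Finset.forall_mem_insert] at hΓ ih
    exact ih ⟨hΓ.1.boxE, hΓ.2⟩ hΔ
  | boxL2 α _ ih =>
    simp only [Finset.forall_mem_insert] at hΓ ih
    exact ih hΓ.2 ⟨.botE _ (.botI (.andI .head (hΓ.1.weak _))), hΔ⟩
  | boxR α _ _ ih₁ ih₂ =>
    have hΔ' := Finset.forall_mem_insert .. |>.1 hΔ
    have hneg : NDder (insert α.neg.emb S) χ := ih₂ (ext _ hΓ) (wk _ hΔ'.2)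
    have hor : NDder S (χ.or α.emb) := ih₁ hΓ (Finset.forall_mem_insert .. |>.2
      ⟨.orI2 _ .head, fun δ hδ => .orI1 _ (hΔ'.2 δ hδ)⟩)
    exact .orE (.boxIstar hor hneg) .head hΔ'.1
  | nboxL α _ _ ih₁ ih₂ =>
    have hΓ' := Finset.forall_mem_insert .. |>.1 hΓ
    have hneg : NDder (insert α.neg.emb S) χ := ih₂ (ext _ hΓ'.2) (wk _ hΔ)
    exact ih₁ hΓ'.2 (Finset.forall_mem_insert .. |>.2
      ⟨hneg.replace (.nboxE (hΓ'.1.weak _) .head), hΔ⟩)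
  | nboxR1 α _ ih =>
    have hΔ' := Finset.forall_mem_insert .. |>.1 hΔ
    exact .orE (.ma α.emb) (ih (ext _ hΓ) (wk _ hΔ'.2)) hΔ'.1
  | nboxR2 α _ ih =>
    simp only [Finset.forall_mem_insert] at hΔ ih
    exact ih hΓ ⟨hΔ.1.replace (.nboxI .head), hΔ.2⟩

theorem NDder.disj_of_mem {S : Set FormulaB} {φ : Formula} (h : NDder S φ.emb)
    (δ : Formula) (δs : List Formula) (hφ : φ ∈ δ :: δs) : NDder S (disj δ δs).emb := by
  induction δs generalizing δ with
  | nil => obtain rfl : φ = δ := by simpa using hφ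
           exact h
  | cons ψ l ih =>
    rcases List.mem_cons.1 hφ with rfl | hφ
    · exact .orI1 _ h
    · exact .orI2 _ (ih ψ hφ)

theorem SCder.mono {c : Bool} {Γ Γ' Δ Δ' : Finset Formula} (h : SCder c Γ Δ) (hΓ : Γ ⊆ Γ')
    (hΔ : Δ ⊆ Δ') : SCder c Γ' Δ' := by
  have hL (Θ : Finset Formula) : SCder c (Θ ∪ Γ) Δ := by
    induction Θ using Finset.induction_on with
    | empty => simpa using h
    | insert α Θ _ ih => simpa [Finset.insert_union] using ih.weakL α
  have hR (Θ : Finset Formula) : SCder c Γ' (Θ ∪ Δ) := by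
    induction Θ using Finset.induction_on with
    | empty => simpa [Finset.union_eq_left.2 hΓ] using hL Γ'
    | insert α Θ _ ih => simpa [Finset.insert_union] using ih.weakR α
  simpa [Finset.union_eq_left.2 hΔ] using hR Δ'

theorem SCder.of_mem {c : Bool} {Γ Δ : Finset Formula} (α : Formula) (hΓ : α ∈ Γ)
    (hΔ : α ∈ Δ) : SCder c Γ Δ :=
  (SCder.ax c α).mono (Finset.singleton_subset_iff.2 hΓ) (Finset.singleton_subset_iff.2 hΔ)

theorem SCder.head {c : Bool} {Γ Δ : Finset Formula} {α : Formula} :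
    SCder c (insert α Γ) (insert α Δ) :=
  .of_mem α (Finset.mem_insert_self α Γ) (Finset.mem_insert_self α Δ)

theorem SCder.subst {Γ Δ : Finset Formula} {α : Formula} (h : SCder true Γ (insert α ∅))
    (h' : SCder true (insert α Γ) Δ) : SCder true Γ Δ :=
  .cut (h.mono subset_rfl (Finset.insert_subset_insert α (Finset.empty_subset Δ))) h'

theorem SCder.contradiction {c : Bool} {Γ Δ : Finset Formula} (α : Formula) :
    SCder c (insert (α.neg.and α.box) Γ) Δ := by
  refine .andL _ _ ?_
  rw [Finset.insert_comm]
  exact .boxL2 _ .head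

/-- The translation replacing `⊥` by the contradiction `¬p ∧ □p`. -/
def FormulaB.unbot : FormulaB → Formula
  | .var n => .var n
  | .bot => .and (.neg (.var 0)) (.box (.var 0))
  | .and φ ψ => .and φ.unbot ψ.unbot
  | .or φ ψ => .or φ.unbot ψ.unbot
  | .neg φ => .neg φ.unbot
  | .box φ => .box φ.unbot

theorem Formula.unbot_emb (φ : Formula) : φ.emb.unbot = φ := by
  induction φ <;> simp_all [Formula.emb, FormulaB.unbot]

theorem NDder.sc {S : Set FormulaB} {φ : FormulaB} (h : NDder S φ) {Γ : Finset Formula}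
    (hΓ : ∀ ψ ∈ S, ψ.unbot ∈ Γ) : SCder true Γ (insert φ.unbot ∅) := by
  have ext {S : Set FormulaB} {Γ : Finset Formula} (hΓ : ∀ ψ ∈ S, ψ.unbot ∈ Γ)
      (φ : FormulaB) : ∀ ψ ∈ insert φ S, ψ.unbot ∈ insert φ.unbot Γ := by
    rintro ψ (rfl | hψ)
    · exact Finset.mem_insert_self ..
    · exact Finset.mem_insert_of_mem (hΓ ψ hψ)
  induction h generalizing Γ with
  | hyp h => exact .of_mem _ (hΓ _ h) (Finset.mem_insert_self ..)
  | ma φ =>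
    refine .orR _ _ ?_
    rw [Finset.insert_comm]
    exact .nboxR1 _ .head
  | andI _ _ ih₁ ih₂ => exact .andR _ _ (ih₁ hΓ) (ih₂ hΓ)
  | andE1 _ ih => exact (ih hΓ).subst (.andL _ _ .head)
  | andE2 _ ih => exact (ih hΓ).subst (.andL _ _ (.weakL _ .head))
  | nandI1 ψ _ ih => exact .nandR _ _ ((ih hΓ).mono subset_rfl (by simp [FormulaB.unbot]))
  | nandI2 φ _ ih => exact .nandR _ _ (.weakR _ (ih hΓ))
  | nandE _ _ _ ih ih₁ ih₂ => exact (ih hΓ).subst (.nandL _ _ (ih₁ (ext hΓ _)) (ih₂ (ext hΓ _)))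
  | orI1 ψ _ ih => exact .orR _ _ ((ih hΓ).mono subset_rfl (by simp))
  | orI2 φ _ ih => exact .orR _ _ (.weakR _ (ih hΓ))
  | orE _ _ _ ih ih₁ ih₂ => exact (ih hΓ).subst (.orL _ _ (ih₁ (ext hΓ _)) (ih₂ (ext hΓ _)))
  | norI _ _ ih₁ ih₂ => exact .norR _ _ (ih₁ hΓ) (ih₂ hΓ)
  | norE1 _ ih => exact (ih hΓ).subst (.norL _ _ .head)
  | norE2 _ ih => exact (ih hΓ).subst (.norL _ _ (.weakL _ .head))
  | nnI _ ih => exact .nnR _ (ih hΓ)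
  | nnE _ ih => exact (ih hΓ).subst (.nnL _ .head)
  | @boxIstar _ _ φ _ _ ih₁ ih₂ =>
    refine .orR _ _ ?_
    rw [Finset.insert_comm]
    exact .boxR _ ((ih₁ hΓ).subst (.orL _ _ (.weakR _ .head) .head)) (ih₂ (ext hΓ φ.neg))
  | boxE _ ih => exact (ih hΓ).subst (.boxL1 _ .head)
  | nboxI _ ih => exact .nboxR2 _ (ih hΓ)
  | nboxE _ _ ih₁ ih₂ =>
    exact (ih₁ hΓ).subst (.nboxL _ ((ih₂ hΓ).mono subset_rfl (by simp)) .head)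
  | botI _ ih => exact (ih hΓ).subst (.contradiction _)
  | botE α _ ih => exact (ih hΓ).subst (.contradiction _)

theorem SCder.disj_left {c : Bool} (Γ : Finset Formula) (δ : Formula) (δs : List Formula) :
    SCder c (insert (disj δ δs) Γ) (δ :: δs).toFinset := by
  induction δs generalizing δ with
  | nil => exact .of_mem δ (by simp [disj]) (by simp)
  | cons ψ l ih =>
    rw [List.toFinset_cons]
    exact .orL _ _ .head (.weakR _ (ih ψ))

/-- Equivalence of `SC_TML` and `ND_TML`: the sequent `Γ ⇒ {δ₁, …, δₖ}` is derivable in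
`SC_TML` iff there is a deduction in `ND_TML` of `δ₁ ∨ ⋯ ∨ δₖ` from the assumptions `Γ`. -/
theorem sc_nd_equivalence (Γ : Finset Formula) (δ : Formula) (δs : List Formula) :
    SCder true Γ ((δ :: δs).toFinset) ↔
      NDder {φ | ∃ γ ∈ Γ, Formula.emb γ = φ} (Formula.emb (disj δ δs)) := by
  constructor
  · intro h
    refine h.nd_cases (fun γ hγ => .hyp ⟨γ, hγ, rfl⟩) fun φ hφ => ?_
    exact NDder.head.disj_of_mem δ δs (List.mem_toFinset.1 hφ)
  · intro h
    have hsc := h.sc (Γ := Γ) (by rintro _ ⟨γ, hγ, rfl⟩; rwa [Formula.unbot_emb])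
    rw [Formula.unbot_emb] at hsc
    exact hsc.subst (.disj_left Γ δ δs)
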